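/- Every skew lattice is biregular: both operations satisfy the regularity identity, i.e., for all x,y,z, x∧y∧x∧z∧x = x∧y∧z∧x and x∨y∨x∨z∨x = x∨y∨z∨x. -/

import Mathlib

/-- A skew lattice: a set with a meet and a join, both associative, related by absorption. -/
structure IsSkewLattice {S : Type*} (m j : S → S → S) : Prop where
  meet_assoc : ∀ x y z, m x (m y z) = m (m x y) z
  join_assoc : ∀ x y z, j x (j y z) = j (j x y) z
  join_meet_right : ∀ x y, j (m y x) x = x
  meet_join_left : ∀ x y, m x (j x y) = x
  meet_join_right : ∀ x y, m (j y x) x = x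
  join_meet_left : ∀ x y, j x (m x y) = x

namespace IsSkewLattice

variable {S : Type*} {m j : S → S → S}

/-- The dual skew lattice, with meet and join exchanged. -/
theorem dual (h : IsSkewLattice m j) : IsSkewLattice j m :=
  ⟨h.join_assoc, h.meet_assoc, h.meet_join_right, h.join_meet_left, h.join_meet_right,
    h.meet_join_left⟩

/-- The opposite skew lattice, with the arguments of both operations exchanged. -/
theorem opposite (h : IsSkewLattice m j) :
    IsSkewLattice (fun x y => m y x) (fun x y => j y x) :=
  ⟨fun x y z => (h.meet_assoc z y x).symm, fun x y z => (h.join_assoc z y x).symm,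
    h.join_meet_left, h.meet_join_right, h.meet_join_left, h.join_meet_right⟩

theorem meet_self (h : IsSkewLattice m j) (x : S) : m x x = x := by
  have := h.meet_join_left x (m x x)
  rwa [h.join_meet_left] at this

/-- Elements that are Green-equivalent for the meet are Green-equivalent for the join. -/
theorem join_join_eq_of_meet_meet_eq (h : IsSkewLattice m j) {x y : S}
    (hx : m (m x y) x = x) (hy : m (m y x) y = y) : j (j x y) x = x := by
  have h₁ : j (m x y) x = m x y := by
    have := h.join_meet_left (m x y) x
    rwa [hx] at this
  have h₂ : j y (m x y) = m x y := by
    have := h.join_meet_right (m x y) y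
    rwa [h.meet_assoc, hy] at this
  have hxw : j (j x y) (m x y) = x := by rw [← h.join_assoc, h₂, h.join_meet_left]
  calc j (j x y) x = j (j x y) (j (j x y) (m x y)) := by rw [hxw]
    _ = x := by rw [h.join_assoc, h.dual.meet_self, hxw]

/-- If the class of `q` lies below that of `u` for the meet, the same holds for the join. -/
theorem join_join_eq_of_meet_meet_eq_right (h : IsSkewLattice m j) {u q : S}
    (hq : m (m q u) q = q) : j (j u q) u = u := by
  have hw : j (j (m (m u q) u) q) (m (m u q) u) = m (m u q) u := by
    apply h.join_join_eq_of_meet_meet_eq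
    · calc m (m (m (m u q) u) q) (m (m u q) u) = m (m u (m (m q u) q)) (m (m u q) u) := by
            simp only [h.meet_assoc]
        _ = m (m u q) u := by rw [hq, h.meet_assoc, h.meet_self]
    · calc m (m q (m (m u q) u)) q = m (m (m (m q u) q) u) q := by simp only [h.meet_assoc]
        _ = q := by rw [hq, hq]
  have h₁ : j u (m (m u q) u) = u := by rw [← h.meet_assoc, h.join_meet_left]
  have h₂ : j (m (m u q) u) u = u := h.join_meet_right _ _
  calc j (j u q) u = j (j (j u (m (m u q) u)) q) (j (m (m u q) u) u) := by rw [h₁, h₂]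
    _ = j u (j (j (j (m (m u q) u) q) (m (m u q) u)) u) := by simp only [h.join_assoc]
    _ = u := by rw [hw, h₂, h.dual.meet_self]

/-- Elements in the same right Green class act equally, from the left, on every lower class. -/
theorem meet_eq_meet_of_lower (h : IsSkewLattice m j) {u v q : S}
    (huv : m u v = v) (hvu : m v u = u) (hq : m (m q u) q = q) : m u q = m v q := by
  have hu := h.join_join_eq_of_meet_meet_eq_right hq
  obtain ⟨e, he⟩ : ∃ e, e = j (j q u) q := ⟨_, rfl⟩
  have hue : j (j u e) u = u := by
    calc j (j u e) u = j (j (j (j u q) u) q) u := by simp only [he, h.join_assoc]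
      _ = u := by rw [hu, hu]
  have heu : j (j e u) e = e := by
    calc j (j e u) e = j (j q (j (j u q) u)) (j (j q u) q) := by simp only [he, h.join_assoc]
      _ = j (j q u) (j (j q u) q) := by rw [hu]
      _ = e := by rw [h.join_assoc, h.dual.meet_self, he]
  have hueu : m (m u e) u = u := h.dual.join_join_eq_of_meet_meet_eq hue heu
  have heue : m (m e u) e = e := h.dual.join_join_eq_of_meet_meet_eq heu hue
  have heq : m e q = q := by rw [he, h.meet_join_right]
  have hv : m u (m e v) = v := by
    calc m u (m e v) = m (m (m u e) u) v := by rw [← h.meet_assoc _ u v, huv, h.meet_assoc]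
      _ = v := by rw [hueu, huv]
  have hvev : m v (m e v) = v := by
    calc m v (m e v) = m (m u (m e v)) (m e v) := by rw [hv]
      _ = v := by rw [← h.meet_assoc, h.meet_self, hv]
  have hveu : m (m v e) u = u := by
    calc m (m v e) u = m (m v (m e v)) u := by
          rw [h.meet_assoc, ← h.meet_assoc _ v u, hvu]
      _ = u := by rw [hvev, hvu]
  calc m u q = m (m (m (m v e) u) e) q := by rw [hveu, ← h.meet_assoc, heq]
    _ = m v (m (m (m e u) e) q) := by simp only [h.meet_assoc]
    _ = m v q := by rw [heue, heq]

/-- Meeting on the right with a fixed element preserves the right Green equivalence. -/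
theorem meet_eq_of_right_related (h : IsSkewLattice m j) {u v : S} (z : S)
    (huv : m u v = v) (hvu : m v u = u) : m (m v z) (m u z) = m u z := by
  have huz : m u (m z (m u z)) = m u z := by rw [h.meet_assoc, h.meet_self]
  have hq : m (m (m z (m u z)) u) (m z (m u z)) = m z (m u z) := by
    calc m (m (m z (m u z)) u) (m z (m u z)) = m z (m (m u z) (m u (m z (m u z)))) := by
          simp only [h.meet_assoc]
      _ = m z (m u z) := by rw [huz, h.meet_self]
  rw [← h.meet_assoc, ← h.meet_eq_meet_of_lower huv hvu hq, huz]

/-- The meet of a skew lattice is a regular band. -/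
theorem meet_regular (h : IsSkewLattice m j) (x y z : S) :
    m (m (m (m x y) x) z) x = m (m (m x y) z) x := by
  have hxyx : m (m x y) (m (m x y) x) = m (m x y) x := by rw [h.meet_assoc, h.meet_self]
  have hxy : m (m (m x y) x) (m x y) = m x y := by
    rw [← h.meet_assoc, h.meet_assoc x x y, h.meet_self, h.meet_self]
  have hzx : m (m z x) (m x (m z x)) = m z x := by
    rw [h.meet_assoc, ← h.meet_assoc z x x, h.meet_self, h.meet_self]
  have hxzx : m (m x (m z x)) (m z x) = m x (m z x) := by rw [← h.meet_assoc, h.meet_self]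
  have hl := h.meet_eq_of_right_related z hxy hxyx
  have hr : m (m y (m z x)) (m y (m x (m z x))) = m y (m z x) :=
    h.opposite.meet_eq_of_right_related y hxzx hzx
  calc m (m (m (m x y) x) z) x = m (m (m (m x y) z) (m (m (m x y) x) z)) x := by rw [hl]
    _ = m x (m (m y (m z x)) (m y (m x (m z x)))) := by simp only [h.meet_assoc]
    _ = m (m (m x y) z) x := by rw [hr]; simp only [h.meet_assoc]

end IsSkewLattice

/-- Every skew lattice is biregular: both operations satisfy the regularity identity
x∧y∧x∧z∧x = x∧y∧z∧x and x∨y∨x∨z∨x = x∨y∨z∨x. Here `mt` is ∧ and `jn` is ∨. -/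
theorem skew_lattice_biregular
    {S : Type*} (mt jn : S → S → S)
    (mt_assoc : ∀ x y z : S, mt x (mt y z) = mt (mt x y) z)
    (jn_assoc : ∀ x y z : S, jn x (jn y z) = jn (jn x y) z)
    (abs1 : ∀ x y : S, jn (mt y x) x = x)
    (abs2 : ∀ x y : S, mt x (jn x y) = x)
    (abs3 : ∀ x y : S, mt (jn y x) x = x)
    (abs4 : ∀ x y : S, jn x (mt x y) = x) :
    ∀ x y z : S,
      mt (mt (mt (mt x y) x) z) x = mt (mt (mt x y) z) x ∧
      jn (jn (jn (jn x y) x) z) x = jn (jn (jn x y) z) x := by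
  have h : IsSkewLattice mt jn := ⟨mt_assoc, jn_assoc, abs1, abs2, abs3, abs4⟩
  exact fun x y z => ⟨h.meet_regular x y z, h.dual.meet_regular x y z⟩
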